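/- In the setting of the context (jump system J, separable convex f, vectors x, s*, t* = −χ_h, x*, the greedy sequence x_0,…,x_k, and the index l): for every j = 1, …, l, it holds that f(x_{j−1} + s_j) − f(x_{j−1}) < f(x + s* + t*) − f(x + s*). -/

import Mathlib

open scoped BigOperators

def l1 {n : ℕ} (x : Fin n → ℤ) : ℤ := ∑ i, |x i|

def UnitVec (n : ℕ) : Set (Fin n → ℤ) :=
  {s | ∃ i : Fin n, s = Pi.single i 1 ∨ s = -Pi.single i 1}

def inc {n : ℕ} (x y : Fin n → ℤ) : Set (Fin n → ℤ) :=
  {s | s ∈ UnitVec n ∧ l1 (x + s - y) = l1 (x - y) - 1}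

def IsJumpSystem {n : ℕ} (J : Set (Fin n → ℤ)) : Prop :=
  J.Nonempty ∧ ∀ x ∈ J, ∀ y ∈ J, ∀ s ∈ inc x y,
    x + s ∉ J → ∃ t ∈ inc (x + s) y, x + s + t ∈ J

def IsSepConvex {n : ℕ} (f : (Fin n → ℤ) → ℝ) : Prop :=
  ∃ g : Fin n → ℤ → ℝ,
    (∀ i k, 2 * g i k ≤ g i (k - 1) + g i (k + 1)) ∧
    ∀ x, f x = ∑ i, g i (x i)

def IsOptimal {n : ℕ} (J : Set (Fin n → ℤ)) (f : (Fin n → ℤ) → ℝ) (y : Fin n → ℤ) : Prop :=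
  y ∈ J ∧ ∀ z ∈ J, f y ≤ f z

noncomputable def mu {n : ℕ} (J : Set (Fin n → ℤ)) (f : (Fin n → ℤ) → ℝ) (x : Fin n → ℤ) : ℤ :=
  sInf {d : ℤ | ∃ y, IsOptimal J f y ∧ d = l1 (y - x)}

def Mstar {n : ℕ} (J : Set (Fin n → ℤ)) (f : (Fin n → ℤ) → ℝ) (x : Fin n → ℤ) : Set (Fin n → ℤ) :=
  {y | IsOptimal J f y ∧ l1 (y - x) = mu J f x}

def DescentS {n : ℕ} (J : Set (Fin n → ℤ)) (f : (Fin n → ℤ) → ℝ) (x s : Fin n → ℤ) : Prop :=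
  s ∈ UnitVec n ∧
  (∃ t, (t ∈ UnitVec n ∨ t = 0) ∧ x + s + t ∈ J ∧ f (x + s + t) < f x) ∧
  ∀ s' ∈ UnitVec n,
    (∃ t, (t ∈ UnitVec n ∨ t = 0) ∧ x + s' + t ∈ J ∧ f (x + s' + t) < f x) →
    f (x + s) ≤ f (x + s')

def DescentT {n : ℕ} (J : Set (Fin n → ℤ)) (f : (Fin n → ℤ) → ℝ) (x s t : Fin n → ℤ) : Prop :=
  (x + s ∈ J ∧ t = 0) ∨
  (x + s ∉ J ∧ t ∈ UnitVec n ∧ x + s + t ∈ J ∧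
    ∀ t' ∈ UnitVec n, x + s + t' ∈ J → f (x + s + t) ≤ f (x + s + t'))

def Sset {n : ℕ} (x s t : Fin n → ℤ) : Set (Fin n → ℤ) :=
  {y | l1 (y - (x + s + t)) = l1 (y - x) - l1 (s + t)}

def CScase {n : ℕ} (x sstar : Fin n → ℤ) (h : Fin n) (xs ss : ℕ → Fin n → ℤ) (l : ℕ) : Prop :=
  xs (l - 1) h + ss l h = x h + sstar h ∧ ss l = Pi.single h 1

def CTcase {n : ℕ} (x sstar : Fin n → ℤ) (h : Fin n) (xs ss ts : ℕ → Fin n → ℤ) (l : ℕ) : Prop :=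
  xs (l - 1) h + ss l h = x h + sstar h - 1 ∧ ts l = Pi.single h 1

theorem l1_add_single {n : ℕ} (w : Fin n → ℤ) (i : Fin n) (e : ℤ) :
    l1 (w + Pi.single i e) = l1 w + |w i + e| - |w i| := by
  unfold l1
  rw [← Finset.add_sum_erase _ _ (Finset.mem_univ i),
    ← Finset.add_sum_erase _ (fun j => |w j|) (Finset.mem_univ i)]
  have : ∑ j ∈ Finset.univ.erase i, |(w + Pi.single i e : Fin n → ℤ) j|
      = ∑ j ∈ Finset.univ.erase i, |w j| := by
    refine Finset.sum_congr rfl fun j hj => ?_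
    simp [Finset.ne_of_mem_erase hj]
  rw [this]
  simp only [Pi.add_apply, Pi.single_eq_same]
  ring

theorem sum_add_single_sub {n : ℕ} (g : Fin n → ℤ → ℝ) (w : Fin n → ℤ) (i : Fin n) (e : ℤ) :
    ∑ j, g j ((w + Pi.single i e : Fin n → ℤ) j) - ∑ j, g j (w j) = g i (w i + e) - g i (w i) := by
  rw [← Finset.add_sum_erase _ _ (Finset.mem_univ i),
    ← Finset.add_sum_erase _ (fun j => g j (w j)) (Finset.mem_univ i)]
  have : ∑ j ∈ Finset.univ.erase i, g j ((w + Pi.single i e : Fin n → ℤ) j)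
      = ∑ j ∈ Finset.univ.erase i, g j (w j) := by
    refine Finset.sum_congr rfl fun j hj => ?_
    simp [Finset.ne_of_mem_erase hj]
  rw [this]
  simp only [Pi.add_apply, Pi.single_eq_same]
  ring

theorem abs_add_neg_one_ne (a : ℤ) : |a + -1| ≠ |a| := by
  grind

theorem neg_single_one {n : ℕ} (i : Fin n) :
    (-Pi.single i 1 : Fin n → ℤ) = Pi.single i (-1) := (Pi.single_neg i 1).symm

theorem mem_inc_iff {n : ℕ} (x y s : Fin n → ℤ) :
    s ∈ inc x y ↔ ∃ i, (s = Pi.single i 1 ∧ x i < y i) ∨ (s = Pi.single i (-1) ∧ y i < x i) := by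
  have key : ∀ (i : Fin n) (e : ℤ),
      l1 (x + Pi.single i e - y) = l1 (x - y) + |x i - y i + e| - |x i - y i| := by
    intro i e
    rw [add_sub_right_comm, l1_add_single]
    rfl
  simp only [inc, UnitVec, Set.mem_ofPred_eq, neg_single_one]
  constructor
  · rintro ⟨⟨i, rfl | rfl⟩, hs⟩
    · rw [key] at hs
      exact ⟨i, Or.inl ⟨rfl, by grind⟩⟩
    · rw [key] at hs
      exact ⟨i, Or.inr ⟨rfl, by grind⟩⟩
  · rintro ⟨i, ⟨rfl, hi⟩ | ⟨rfl, hi⟩⟩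
    · exact ⟨⟨i, Or.inl rfl⟩, by rw [key]; grind⟩
    · exact ⟨⟨i, Or.inr rfl⟩, by rw [key]; grind⟩

theorem forward_diff_mono {g : ℤ → ℝ} (hg : ∀ k, 2 * g k ≤ g (k - 1) + g (k + 1)) {v w : ℤ}
    (hvw : v ≤ w) : g (v + 1) - g v ≤ g (w + 1) - g w := by
  induction w, hvw using Int.leInduction with
  | base => exact le_rfl
  | succ w _ ih =>
    have := hg (w + 1)
    rw [add_sub_cancel_right] at this
    linarith

/-- Moving by a vector of `inc x y` keeps every coordinate between those of `x` and `y`. -/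
theorem between_of_mem_inc {n : ℕ} {x y s : Fin n → ℤ} (hs : s ∈ inc x y) (i : Fin n) :
    (x i ≤ (x + s) i ∧ (x + s) i ≤ y i) ∨ (y i ≤ (x + s) i ∧ (x + s) i ≤ x i) := by
  obtain ⟨a, ⟨rfl, ha⟩ | ⟨rfl, ha⟩⟩ := (mem_inc_iff _ _ _).1 hs <;>
  · by_cases h : i = a
    · subst h
      simp only [Pi.add_apply, Pi.single_eq_same]
      omega
    · simp only [Pi.add_apply, Pi.single_eq_of_ne h]
      omega

theorem mem_inc_comm {n : ℕ} {x y s t : Fin n → ℤ} (hs : s ∈ inc x y) (ht : t ∈ inc (x + s) y) :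
    t ∈ inc x y ∧ s ∈ inc (x + t) y := by
  obtain ⟨a, ha⟩ := (mem_inc_iff _ _ _).1 hs
  obtain ⟨b, hb⟩ := (mem_inc_iff _ _ _).1 ht
  have h1 : t ∈ inc x y := by
    refine (mem_inc_iff _ _ _).2 ⟨b, ?_⟩
    by_cases h : b = a
    · subst h
      rcases ha with ⟨rfl, ha⟩ | ⟨rfl, ha⟩ <;>
        simp only [Pi.add_apply, Pi.single_eq_same] at hb <;> grind
    · rcases ha with ⟨rfl, ha⟩ | ⟨rfl, ha⟩ <;>
        simpa only [Pi.add_apply, Pi.single_eq_of_ne h, add_zero] using hb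
  refine ⟨h1, hs.1, ?_⟩
  have e : x + t + s - y = x + s + t - y := by abel
  rw [e, ht.2, hs.2, h1.2]

/-- If a step `s + t` towards `z` changes coordinate `i`, and `s` is at least as good a first move
as `t`, then the unit move in coordinate `i` towards `z` has at least the slope of `s`. -/
theorem slope_le_of_step {n : ℕ} (g : Fin n → ℤ → ℝ) {y z s t : Fin n → ℤ} (hs : s ∈ inc y z)
    (ht : t = 0 ∨ t ∈ inc (y + s) z)
    (hst : t ∈ inc (y + s) z → ∑ j, g j ((y + s) j) ≤ ∑ j, g j ((y + t) j)) (i : Fin n) :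
    (y + s + t) i = y i ∨
    (y i < z i ∧
      ∑ j, g j ((y + s) j) - ∑ j, g j (y j) ≤ g i (y i + 1) - g i (y i)) ∨
    (z i < y i ∧
      ∑ j, g j ((y + s) j) - ∑ j, g j (y j) ≤ g i (y i + -1) - g i (y i)) := by
  have slope : ∀ u ∈ inc y z, u i = 0 ∨
      (y i < z i ∧ ∑ j, g j ((y + u) j) - ∑ j, g j (y j) = g i (y i + 1) - g i (y i)) ∨
      (z i < y i ∧ ∑ j, g j ((y + u) j) - ∑ j, g j (y j) = g i (y i + -1) - g i (y i)) := by
    intro u hu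
    obtain ⟨a, ha⟩ := (mem_inc_iff _ _ _).1 hu
    by_cases h : i = a
    · subst h
      rcases ha with ⟨rfl, ha⟩ | ⟨rfl, ha⟩
      · exact Or.inr (Or.inl ⟨ha, sum_add_single_sub _ _ _ _⟩)
      · exact Or.inr (Or.inr ⟨ha, sum_add_single_sub _ _ _ _⟩)
    · rcases ha with ⟨rfl, ha⟩ | ⟨rfl, ha⟩ <;> exact Or.inl (Pi.single_eq_of_ne h _)
  rcases slope s hs with h0 | ⟨h1, h2⟩ | ⟨h1, h2⟩
  · rcases ht with rfl | ht
    · left; simp [h0]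
    · rcases slope t (mem_inc_comm hs ht).1 with h3 | ⟨h1, h2⟩ | ⟨h1, h2⟩
      · left; simp [h0, h3]
      · exact Or.inr (Or.inl ⟨h1, by linarith [hst ht]⟩)
      · exact Or.inr (Or.inr ⟨h1, by linarith [hst ht]⟩)
  · exact Or.inr (Or.inl ⟨h1, h2.le⟩)
  · exact Or.inr (Or.inr ⟨h1, h2.le⟩)

theorem stmt13 {n : ℕ} (J : Set (Fin n → ℤ)) (f : (Fin n → ℤ) → ℝ)
    (x sstar tstar xstar : Fin n → ℤ) (h : Fin n)
    (k l : ℕ) (xs ss ts : ℕ → Fin n → ℤ)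
    (hn : 2 ≤ n) (hJ : IsJumpSystem J) (hJfin : J.Finite) (hf : IsSepConvex f)
    (hxJ : x ∈ J) (hxopt : ¬ IsOptimal J f x)
    (hall : ∀ y, IsOptimal J f y → y ∈ Mstar J f x)
    (hs : DescentS J f x sstar) (hxs : x + sstar ∉ J)
    (htd : tstar = -Pi.single h 1) (ht : DescentT J f x sstar tstar)
    (htnot : ∀ x' ∈ Mstar J f x, sstar ∈ inc x x' → tstar ∉ inc (x + sstar) x')
    (hx1 : xstar ∈ Mstar J f x) (hx2 : sstar ∈ inc x xstar)
    (hx3 : ∀ x' ∈ Mstar J f x, sstar ∈ inc x x' → xstar h ≤ x' h)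
    (hk : 1 ≤ k)
    (hxs0 : xs 0 = x + sstar + tstar) (hxsk : xs k = xstar)
    (hseq : ∀ j, 1 ≤ j → j ≤ k →
      xs j ∈ J ∧ ss j ∈ UnitVec n ∧ (ts j ∈ UnitVec n ∨ ts j = 0) ∧
      xs j = xs (j - 1) + ss j + ts j ∧
      ss j ∈ inc (xs (j - 1)) xstar ∧
      (∃ t, (t ∈ inc (xs (j - 1) + ss j) xstar ∨ t = 0) ∧
        xs (j - 1) + ss j + t ∈ J ∧ f (xs (j - 1) + ss j + t) < f (xs (j - 1))) ∧
      (∀ s ∈ inc (xs (j - 1)) xstar,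
        (∃ t, (t ∈ inc (xs (j - 1) + s) xstar ∨ t = 0) ∧
          xs (j - 1) + s + t ∈ J ∧ f (xs (j - 1) + s + t) < f (xs (j - 1))) →
        f (xs (j - 1) + ss j) ≤ f (xs (j - 1) + s)) ∧
      (xs (j - 1) + ss j ∈ J → ts j = 0) ∧
      (xs (j - 1) + ss j ∉ J →
        ts j ∈ inc (xs (j - 1) + ss j) xstar ∧
        f (xs (j - 1) + ss j + ts j) < f (xs (j - 1)) ∧
        ∀ t ∈ inc (xs (j - 1) + ss j) xstar,
          xs (j - 1) + ss j + t ∈ J → f (xs (j - 1) + ss j + t) < f (xs (j - 1)) →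
          f (xs (j - 1) + ss j + ts j) ≤ f (xs (j - 1) + ss j + t)) ∧
      (∃ i, (ss j = Pi.single i 1 ∧ xs 0 i < xstar i) ∨
            (ss j = -Pi.single i 1 ∧ xstar i < xs 0 i)) ∧
      (ts j = 0 ∨ ∃ i, (ts j = Pi.single i 1 ∧ xs 0 i < xstar i) ∨
            (ts j = -Pi.single i 1 ∧ xstar i < xs 0 i)))
    (hmono : ∀ j, 1 ≤ j → j + 1 ≤ k →
      f (xs (j - 1) + ss j) - f (xs (j - 1)) ≤ f (xs j + ss (j + 1)) - f (xs j))
    (hl1 : 1 ≤ l) (hl2 : l ≤ k) (hl3 : x h + sstar h ≤ xs l h)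
    (hl4 : ∀ l', 1 ≤ l' → l' < l → xs l' h < x h + sstar h)
    (hcase : (CScase x sstar h xs ss l ∧ ¬ CTcase x sstar h xs ss ts l) ∨
             (CTcase x sstar h xs ss ts l ∧ ¬ CScase x sstar h xs ss l))
    :
    ∀ j, 1 ≤ j → j ≤ l →
      f (xs (j - 1) + ss j) - f (xs (j - 1)) < f (x + sstar + tstar) - f (x + sstar) := by
  obtain ⟨g, hg, hfg⟩ := hf
  obtain ⟨p, rfl⟩ : ∃ p, l = p + 1 := ⟨l - 1, by omega⟩
  have hdiff : ∀ w i e, f (w + Pi.single i e) - f w = g i (w i + e) - g i (w i) := by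
    intro w i e
    rw [hfg, hfg]
    exact sum_add_single_sub g w i e
  have hstep : ∀ j, j + 1 ≤ k → xs (j + 1) = xs j + ss (j + 1) + ts (j + 1) ∧
      ss (j + 1) ∈ inc (xs j) xstar ∧
      (ts (j + 1) = 0 ∨ ts (j + 1) ∈ inc (xs j + ss (j + 1)) xstar) ∧
      (ts (j + 1) ∈ inc (xs j + ss (j + 1)) xstar →
        f (xs j + ss (j + 1)) ≤ f (xs j + ts (j + 1))) := by
    intro j hj
    obtain ⟨hJj, -, -, heq, hinc, hex, hmin, h0, h1, -, -⟩ := hseq (j + 1) (by omega) hj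
    simp only [Nat.add_sub_cancel] at heq hinc hex hmin h0 h1
    refine ⟨heq, hinc, ?_, ?_⟩
    · by_cases hc : xs j + ss (j + 1) ∈ J
      · exact Or.inl (h0 hc)
      · exact Or.inr (h1 hc).1
    · intro hti
      have hc : xs j + ss (j + 1) ∉ J := by
        intro hc
        obtain ⟨a, ⟨ha, -⟩ | ⟨ha, -⟩⟩ := (mem_inc_iff _ _ _).1 hti <;>
        · have := congrFun ((h0 hc).symm.trans ha) a
          simp at this
      obtain ⟨h2, h3⟩ := mem_inc_comm hinc hti
      refine hmin _ h2 ⟨_, Or.inl h3, ?_⟩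
      rw [add_right_comm]
      exact ⟨heq ▸ hJj, (h1 hc).2.1⟩
  have hbtw : ∀ j, j ≤ k → ∀ i, (xs 0 i ≤ xs j i ∧ xs j i ≤ xstar i) ∨
      (xstar i ≤ xs j i ∧ xs j i ≤ xs 0 i) := by
    intro j
    induction j with
    | zero => intro _ i; omega
    | succ j ih =>
      intro hj i
      obtain ⟨heq, hinc, ht', -⟩ := hstep j hj
      have a1 := ih (by omega) i
      have a2 := between_of_mem_inc hinc i
      have a3 : ((xs j + ss (j + 1)) i ≤ xs (j + 1) i ∧ xs (j + 1) i ≤ xstar i) ∨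
          (xstar i ≤ xs (j + 1) i ∧ xs (j + 1) i ≤ (xs j + ss (j + 1)) i) := by
        rw [heq]
        rcases ht' with h0 | h1
        · rw [h0, add_zero]; omega
        · exact between_of_mem_inc h1 i
      omega
  have hslope : ∀ j m, j + m + 1 ≤ k →
      f (xs j + ss (j + 1)) - f (xs j) ≤ f (xs (j + m) + ss (j + m + 1)) - f (xs (j + m)) := by
    intro j m
    induction m with
    | zero => intro _; exact le_rfl
    | succ m ih =>
      intro hm
      have := hmono (j + m + 1) (by omega) (by omega)
      simp only [Nat.add_sub_cancel] at this
      exact (ih (by omega)).trans this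
  set σ := f (xs p + ss (p + 1)) - f (xs p) with hσ
  have hpath : ∀ i m, p + m ≤ k → xs (p + m) i = xs p i ∨
      (xs p i < xstar i ∧ σ ≤ g i (xs p i + 1) - g i (xs p i)) ∨
      (xstar i < xs p i ∧ σ ≤ g i (xs p i + -1) - g i (xs p i)) := by
    intro i m
    induction m with
    | zero => intro _; exact Or.inl rfl
    | succ m ih =>
      intro hm
      rcases ih (by omega) with he | h1
      · obtain ⟨heq, hinc, ht', hst⟩ := hstep (p + m) (by omega)
        have hσ' := hslope p m (by omega)
        rw [hfg, hfg] at hst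
        have := slope_le_of_step g hinc ht' hst i
        rw [← heq, ← hfg, ← hfg, he] at this
        rcases this with h1 | ⟨h1, h2⟩ | ⟨h1, h2⟩
        · exact Or.inl h1
        · exact Or.inr (Or.inl ⟨h1, hσ'.trans h2⟩)
        · exact Or.inr (Or.inr ⟨h1, hσ'.trans h2⟩)
      · exact Or.inr h1
  have hend : ∀ i, xstar i = xs p i ∨
      (xs p i < xstar i ∧ σ ≤ g i (xs p i + 1) - g i (xs p i)) ∨
      (xstar i < xs p i ∧ σ ≤ g i (xs p i + -1) - g i (xs p i)) := by
    intro i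
    have := hpath i (k - p) (by omega)
    rwa [show p + (k - p) = k by omega, hxsk] at this
  rw [neg_single_one] at htd
  subst htd
  have hxstar_ge : x h + sstar h ≤ xstar h := by
    by_contra hlt
    exact htnot xstar hx1 hx2 ((mem_inc_iff _ _ _).2 ⟨h, Or.inr ⟨rfl, not_le.1 hlt⟩⟩)
  have hxp : xs p h < x h + sstar h := by
    rcases Nat.eq_zero_or_pos p with rfl | hp
    · rw [hxs0]; simp
    · exact hl4 p hp (by omega)
  have hmonog := fun i (v w : ℤ) (hvw : v ≤ w) => forward_diff_mono (hg i) hvw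
  suffices hmain : σ < f (x + sstar + Pi.single h (-1)) - f (x + sstar) by
    intro j hj1 hj2
    obtain ⟨q, rfl⟩ : ∃ q, j = q + 1 := ⟨j - 1, by omega⟩
    have := hslope q (p - q) (by omega)
    rw [show q + (p - q) = p by omega] at this
    simp only [Nat.add_sub_cancel]
    exact this.trans_lt hmain
  by_contra! hcon
  rw [hdiff] at hcon
  simp only [Pi.add_apply] at hcon
  set c := x h + sstar h with hc
  have hd : σ ≤ g h c - g h (c + -1) := by
    have := hmonog h (xs p h) (c + -1) (by omega)
    rw [show c + -1 + 1 = c by ring] at this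
    rcases hend h with h1 | ⟨h1, h2⟩ | ⟨h1, h2⟩
    · omega
    · linarith
    · omega
  have hz : f (xstar + Pi.single h (-1)) - f xstar ≤ g h (c + -1) - g h c := by
    rw [hdiff]
    have := hmonog h (c + -1) (xstar h + -1) (by omega)
    rw [show c + -1 + 1 = c by ring, show xstar h + -1 + 1 = xstar h by ring] at this
    linarith
  have hopt : ∀ y ∈ J, f y ≤ f xstar → y ∈ Mstar J f x := fun y hy hle =>
    hall y ⟨hy, fun w hw => hle.trans (hx1.1.2 w hw)⟩
  have hpJ : xs p ∈ J := by
    rcases Nat.eq_zero_or_pos p with rfl | hp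
    · rw [hxs0]
      rcases ht with ⟨h1, -⟩ | h1
      · exact absurd h1 hxs
      · exact h1.2.2.1
    · exact (hseq p hp (by omega)).1
  have hzJ : xstar + Pi.single h (-1) ∉ J := by
    intro hzJ
    have h1 := (hopt _ hzJ (by linarith)).2
    rw [← hx1.2, add_sub_right_comm, l1_add_single] at h1
    exact abs_add_neg_one_ne _ (by linarith)
  obtain ⟨t, htinc, htJ⟩ := hJ.2 xstar hx1.1.1 (xs p) hpJ (Pi.single h (-1))
    ((mem_inc_iff _ _ _).2 ⟨h, Or.inr ⟨rfl, by omega⟩⟩) hzJ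
  have hzle : ∀ i, (xstar + Pi.single h (-1) : Fin n → ℤ) i ≤ xstar i := by
    intro i
    by_cases hi : i = h
    · subst hi; simp
    · simp [hi]
  have hzne : ∀ i, i ≠ h → (xstar + Pi.single h (-1) : Fin n → ℤ) i = xstar i := by
    intro i hi; simp [hi]
  have hzh : (xstar + Pi.single h (-1) : Fin n → ℤ) h = xstar h + -1 := by simp
  set z := xstar + Pi.single h (-1) with hzdef
  have htle : f (z + t) - f z ≤ -σ := by
    obtain ⟨i, ⟨rfl, hi⟩ | ⟨rfl, hi⟩⟩ := (mem_inc_iff _ _ _).1 htinc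
    · have hih : i ≠ h := by rintro rfl; omega
      rw [hdiff]
      have e := hzne i hih
      have := hmonog i (z i) (xs p i + -1) (by omega)
      rw [show xs p i + -1 + 1 = xs p i by ring] at this
      rcases hend i with h1 | ⟨h1, h2⟩ | ⟨h1, h2⟩
      · omega
      · omega
      · linarith
    · rw [hdiff]
      have e := hzle i
      have := hmonog i (xs p i) (z i + -1) (by omega)
      rw [show z i + -1 + 1 = z i by ring] at this
      rcases hend i with h1 | ⟨h1, h2⟩ | ⟨h1, h2⟩
      · omega
      · linarith
      · omega
  have hyM : z + t ∈ Mstar J f x := hopt _ htJ (by linarith)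
  have hbz := between_of_mem_inc htinc
  have hyh : (z + t) h < xstar h := by
    have := hbz h
    omega
  refine absurd (hx3 _ hyM ?_) (not_le.2 hyh)
  have hsne : sstar ≠ Pi.single h 1 := by
    rintro rfl
    have hx0 : x + Pi.single h 1 + Pi.single h (-1) = x := by
      rw [add_assoc, ← Pi.single_add]; simp
    rcases ht with ⟨h1, -⟩ | ⟨-, -, -, h2⟩
    · exact hxs h1
    · obtain ⟨t', ht' | rfl, hJ', hlt⟩ := hs.2.1
      · have := h2 t' ht' hJ'
        rw [hx0] at this
        linarith
      · rw [add_zero] at hJ'; exact hxs hJ'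
  obtain ⟨a, ha⟩ := (mem_inc_iff _ _ _).1 hx2
  refine (mem_inc_iff _ _ _).2 ⟨a, ?_⟩
  have hbp := hbtw p (by omega) a
  have hba := hbz a
  have hx0 := congrFun hxs0 a
  rcases ha with ⟨rfl, ha⟩ | ⟨rfl, ha⟩
  · have hah : a ≠ h := by rintro rfl; exact hsne rfl
    have e := hzne a hah
    simp [hah] at hx0
    exact Or.inl ⟨rfl, by omega⟩
  · refine Or.inr ⟨rfl, ?_⟩
    by_cases hah : a = h
    · subst hah
      omega
    · have e := hzne a hah
      simp [hah] at hx0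
      omega
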